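/- arXiv:1707.09940 — 5 statements merged into one kernel-verified Lean document; each statement's English description precedes it below -/
import Mathlib

section
/- Let Q, Z ∈ ℂ^{M×M} be Hermitian positive definite, let ξ_1,…,ξ_K ∈ ℂ^{M²} be the columns of Ξ ∈ ℂ^{M²×K}, let p_1,…,p_K > 0, and P = diag(p_1,…,p_K). Define the Hermitian positive semidefinite matrix Γ = (1/M)·Ξᴴ((Qᵀ)⁻¹⊗Z⁻¹)Ξ ∈ ℂ^{K×K}. Then for every k ∈ {1,…,K} the matrix Qᵀ⊗Z + Σ_{n≠k} p_n ξ_n ξ_nᴴ is invertible and the real number p_k · ξ_kᴴ (Qᵀ⊗Z + Σ_{n≠k} p_n ξ_n ξ_nᴴ)⁻¹ ξ_k equals M·p_k · (e_kᵀ Γ ((1/M)P⁻¹ + Γ)⁻¹ e_k) / (e_kᵀ ((1/M)P⁻¹ + Γ)⁻¹ e_k), where both numerator and denominator of the right-hand side are real and the denominator is positive. -/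
open Matrix
open scoped Kronecker ComplexOrder

/-- A positive definite matrix stays positive definite after adding nonnegative multiples of
rank-one matrices `v vᴴ`. -/
lemma posDef_add_sum_smul_vecMulVec {m ι : Type*} [Fintype m]
    {A : Matrix m m ℂ} (hA : A.PosDef) (s : Finset ι) (p : ι → ℝ) (hp : ∀ n, 0 ≤ p n)
    (v : ι → m → ℂ) :
    (A + ∑ n ∈ s, (p n : ℂ) • vecMulVec (v n) (star (v n))).PosDef := by
  refine hA.add_posSemidef (posSemidef_sum s fun n _ => ?_)
  exact (posSemidef_vecMulVec_self_star (v n)).smul (by exact_mod_cast hp n)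

/-- `P⁻¹ + Xᴴ A⁻¹ X` is positive definite for `A` positive definite and `P` a positive diagonal. -/
lemma posDef_diagonal_inv_add_gram {m ι : Type*} [Fintype m] [DecidableEq m] [Fintype ι]
    [DecidableEq ι] {A : Matrix m m ℂ} (hA : A.PosDef) (X : Matrix m ι ℂ) (p : ι → ℝ)
    (hp : ∀ n, 0 < p n) :
    (diagonal (fun n => ((p n : ℂ))⁻¹) + Xᴴ * A⁻¹ * X).PosDef := by
  refine PosDef.add_posSemidef (PosDef.diagonal fun n => ?_)
    (hA.inv.posSemidef.conjTranspose_mul_mul_same X)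
  have : (0 : ℝ) < (p n)⁻¹ := inv_pos.2 (hp n)
  exact_mod_cast this

/-- The rank-one-removed quadratic form in terms of a diagonal entry of `(P⁻¹ + Xᴴ A⁻¹ X)⁻¹`. -/
lemma star_dotProduct_inv_mulVec_eq {m ι : Type*} [Fintype m] [DecidableEq m] [Fintype ι]
    [DecidableEq ι] {A : Matrix m m ℂ} (hA : A.PosDef) (v : ι → m → ℂ) (X : Matrix m ι ℂ)
    (hX : X = Matrix.of fun q n => v n q) (p : ι → ℝ) (hp : ∀ n, 0 < p n) (k : ι) :
    star (v k) ⬝ᵥ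
        (A + ∑ n ∈ Finset.univ.erase k, (p n : ℂ) • vecMulVec (v n) (star (v n)))⁻¹ *ᵥ v k =
      ((diagonal (fun n => ((p n : ℂ))⁻¹) + Xᴴ * A⁻¹ * X)⁻¹ k k)⁻¹ - ((p k : ℂ))⁻¹ := by
  have hS := posDef_diagonal_inv_add_gram hA X p hp
  have hR := posDef_add_sum_smul_vecMulVec hA (Finset.univ.erase k) p (fun n => (hp n).le) v
  set S := diagonal (fun n => ((p n : ℂ))⁻¹) + Xᴴ * A⁻¹ * X with hSdef
  set R := A + ∑ n ∈ Finset.univ.erase k, (p n : ℂ) • vecMulVec (v n) (star (v n)) with hRdef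
  have hs : S⁻¹ k k ≠ 0 := hS.inv.diag_pos.ne'
  have hSdet : IsUnit S.det := (isUnit_iff_isUnit_det S).1 hS.isUnit
  have hRdet : IsUnit R.det := (isUnit_iff_isUnit_det R).1 hR.isUnit
  have hAdet : IsUnit A.det := (isUnit_iff_isUnit_det A).1 hA.isUnit
  set y : ι → ℂ := fun n => S⁻¹ n k with hy
  set w : m → ℂ := A⁻¹ *ᵥ (X *ᵥ y) with hw
  have hSy : S *ᵥ y = Pi.single k 1 := by
    have : y = S⁻¹ *ᵥ Pi.single k 1 := by ext n; simp [hy]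
    rw [this, mulVec_mulVec, mul_nonsing_inv _ hSdet, one_mulVec]
  have hvw (n : ι) : star (v n) ⬝ᵥ w = (Pi.single k 1 : ι → ℂ) n - (p n : ℂ)⁻¹ * y n := by
    have h1 : (Xᴴ *ᵥ w) n = star (v n) ⬝ᵥ w := by
      subst hX; rfl
    rw [← h1, ← hSy, hSdef, add_mulVec, Pi.add_apply, mulVec_diagonal, hw, mulVec_mulVec,
      mulVec_mulVec, add_sub_cancel_left]
  have hXy : X *ᵥ y = ∑ n, y n • v n := by
    subst hX
    ext q
    simp [mulVec, dotProduct, mul_comm]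
  have hRw : R *ᵥ w = y k • v k := by
    have hAw : A *ᵥ w = ∑ n, y n • v n := by
      rw [hw, mulVec_mulVec, mul_nonsing_inv _ hAdet, one_mulVec, hXy]
    have hsum : ∑ n ∈ Finset.univ.erase k, ((p n : ℂ) • vecMulVec (v n) (star (v n))) *ᵥ w =
        -∑ n ∈ Finset.univ.erase k, y n • v n := by
      rw [← Finset.sum_neg_distrib]
      refine Finset.sum_congr rfl fun n hn => ?_
      have hpn : (p n : ℂ) ≠ 0 := by exact_mod_cast (hp n).ne'
      ext q
      rw [smul_mulVec, vecMulVec_mulVec, hvw, Pi.single_eq_of_ne (Finset.ne_of_mem_erase hn)]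
      simp
      field_simp
    rw [hRdef, add_mulVec, sum_mulVec, hsum, hAw,
      ← Finset.add_sum_erase _ _ (Finset.mem_univ k)]
    abel
  have hRv : R⁻¹ *ᵥ v k = (y k)⁻¹ • w := by
    have : v k = (y k)⁻¹ • (R *ᵥ w) := by rw [hRw, smul_smul, inv_mul_cancel₀ hs, one_smul]
    rw [this, mulVec_smul, mulVec_mulVec, nonsing_inv_mul _ hRdet, one_mulVec]
  rw [hRv, dotProduct_smul, hvw, Pi.single_eq_same, smul_eq_mul, mul_sub, mul_one,
    mul_left_comm, inv_mul_cancel₀ hs, mul_one]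

/-- SINR reformulation (Lemma 1, eq. (30)): the optimal bilinear-equalizer SINR
`p_k ξ_kᴴ (Qᵀ⊗Z + Σ_{n≠k} p_n ξ_n ξ_nᴴ)⁻¹ ξ_k` equals
`M p_k (e_kᵀ Γ ((1/M)P⁻¹+Γ)⁻¹ e_k)/(e_kᵀ ((1/M)P⁻¹+Γ)⁻¹ e_k)`. -/
theorem obe_sinr_reformulation
    (M K : ℕ) (hM : 0 < M)
    (Q Z : Matrix (Fin M) (Fin M) ℂ) (hQ : Q.PosDef) (hZ : Z.PosDef)
    (ξ : Fin K → (Fin M × Fin M) → ℂ)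
    (Ξ : Matrix (Fin M × Fin M) (Fin K) ℂ) (hΞ : Ξ = Matrix.of fun q k => ξ k q)
    (p : Fin K → ℝ) (hp : ∀ k, 0 < p k)
    (P : Matrix (Fin K) (Fin K) ℂ) (hP : P = Matrix.diagonal fun k => (p k : ℂ))
    (Γ : Matrix (Fin K) (Fin K) ℂ)
    (hΓ : Γ = ((1 : ℂ) / M) • (Ξᴴ * ((Qᵀ)⁻¹ ⊗ₖ Z⁻¹) * Ξ))
    (k : Fin K) :
    IsUnit (Qᵀ ⊗ₖ Z + ∑ n ∈ Finset.univ.erase k, (p n : ℂ) • vecMulVec (ξ n) (star (ξ n))) ∧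
    ((Γ * (((1 : ℂ) / M) • P⁻¹ + Γ)⁻¹) k k).im = 0 ∧
    (((((1 : ℂ) / M) • P⁻¹ + Γ)⁻¹) k k).im = 0 ∧
    0 < (((((1 : ℂ) / M) • P⁻¹ + Γ)⁻¹) k k).re ∧
    (p k : ℂ) * (star (ξ k) ⬝ᵥ
        (Qᵀ ⊗ₖ Z + ∑ n ∈ Finset.univ.erase k, (p n : ℂ) • vecMulVec (ξ n) (star (ξ n)))⁻¹ *ᵥ ξ k) =
      (M : ℂ) * (p k : ℂ) * ((Γ * (((1 : ℂ) / M) • P⁻¹ + Γ)⁻¹) k k) /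
        (((((1 : ℂ) / M) • P⁻¹ + Γ)⁻¹) k k) := by
  have hA : (Qᵀ ⊗ₖ Z).PosDef := hQ.transpose.kronecker hZ
  have hM' : (M : ℂ) ≠ 0 := by exact_mod_cast hM.ne'
  have hpk : (p k : ℂ) ≠ 0 := by exact_mod_cast (hp k).ne'
  have hPinv : P⁻¹ = diagonal fun n => ((p n : ℂ))⁻¹ := by
    refine inv_eq_left_inv ?_
    rw [hP, diagonal_mul_diagonal, ← diagonal_one]
    congr 1
    ext n
    exact inv_mul_cancel₀ (by exact_mod_cast (hp n).ne')
  have hS := posDef_diagonal_inv_add_gram hA Ξ p hp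
  have hSINR := star_dotProduct_inv_mulVec_eq hA ξ Ξ hΞ p hp k
  rw [hPinv, hΓ, ← inv_kronecker, ← smul_add]
  set D : Matrix (Fin K) (Fin K) ℂ := diagonal fun n => ((p n : ℂ))⁻¹ with hD
  set G := Ξᴴ * (Qᵀ ⊗ₖ Z)⁻¹ * Ξ with hG
  have hSdet : IsUnit (D + G).det := (isUnit_iff_isUnit_det _).1 hS.isUnit
  have hT : (((1 : ℂ) / M) • (D + G))⁻¹ = (M : ℂ) • (D + G)⁻¹ := by
    refine inv_eq_left_inv ?_
    rw [smul_mul_smul_comm, nonsing_inv_mul _ hSdet, mul_one_div_cancel hM', one_smul]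
  have hΓT : (((1 : ℂ) / M) • G * ((M : ℂ) • (D + G)⁻¹)) k k =
      1 - (p k : ℂ)⁻¹ * (D + G)⁻¹ k k := by
    have : G * (D + G)⁻¹ = 1 - D * (D + G)⁻¹ := by
      rw [eq_sub_iff_add_eq', ← add_mul, mul_nonsing_inv _ hSdet]
    rw [smul_mul_smul_comm, one_div_mul_cancel hM', one_smul, this, Matrix.sub_apply, one_apply_eq, hD,
      diagonal_mul]
  obtain ⟨hre, him⟩ := Complex.pos_iff.1 (hS.inv.diag_pos (i := k))
  have hs : (D + G)⁻¹ k k ≠ 0 := hS.inv.diag_pos.ne'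
  rw [hT, hΓT, hSINR]
  refine ⟨(posDef_add_sum_smul_vecMulVec hA _ p (fun n => (hp n).le) ξ).isUnit, ?_, ?_, ?_, ?_⟩
  · rw [← Complex.ofReal_inv, Complex.sub_im, Complex.im_ofReal_mul, ← him]
    simp
  · simp [← him]
  · have : (0 : ℝ) < M := by exact_mod_cast hM
    simpa using mul_pos this hre
  · rw [Matrix.smul_apply, smul_eq_mul]
    field_simp
end

section
/- Let Q, Z ∈ ℂ^{M×M} be Hermitian positive definite, ξ_1,…,ξ_K ∈ ℂ^{M²} the columns of Ξ, p_1,…,p_K > 0, P = diag(p_1,…,p_K), and set Υ = Qᵀ⊗Z + ΞPΞᴴ. Fix k and let a_k⋆ = (Qᵀ⊗Z + Σ_{n≠k} p_n ξ_n ξ_nᴴ)⁻¹ ξ_k and ã_k = Υ⁻¹ ξ_k. Then the quantity 1 − p_k·ξ_kᴴΥ⁻¹ξ_k is real and strictly positive, and a_k⋆ = ã_k / (1 − p_k·ξ_kᴴΥ⁻¹ξ_k); in particular, the optimal transformation a_k⋆ is a positive scalar multiple of ã_k. -/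
open Matrix
open scoped Kronecker ComplexOrder

/-- Sherman–Morrison for a positive definite matrix `B` and a rank-one update along `v`, with the
scaling factor written through the updated matrix. -/
theorem Matrix.PosDef.inv_mulVec_eq_smul_inv_add_vecMulVec {n : Type*} [Fintype n] [DecidableEq n]
    {B : Matrix n n ℂ} (hB : B.PosDef) (v : n → ℂ) {c : ℝ} (hc : 0 ≤ c) :
    let U := B + (c : ℂ) • vecMulVec v (star v)
    0 < 1 - (c : ℂ) * (star v ⬝ᵥ U⁻¹ *ᵥ v) ∧
      B⁻¹ *ᵥ v = (1 - (c : ℂ) * (star v ⬝ᵥ U⁻¹ *ᵥ v))⁻¹ • U⁻¹ *ᵥ v := by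
  intro U
  have hc' : (0 : ℂ) ≤ (c : ℂ) := by exact_mod_cast hc
  have hU : U.PosDef := hB.add_posSemidef ((posSemidef_vecMulVec_self_star v).smul hc')
  set s := star v ⬝ᵥ B⁻¹ *ᵥ v with hs
  have hs0 : 0 ≤ s := hB.inv.posSemidef.dotProduct_mulVec_nonneg v
  have h1 : 0 < 1 + (c : ℂ) * s := add_pos_of_pos_of_nonneg one_pos (mul_nonneg hc' hs0)
  have hBv : B *ᵥ B⁻¹ *ᵥ v = v := by
    rw [mulVec_mulVec, mul_nonsing_inv _ ((isUnit_iff_isUnit_det B).mp hB.isUnit), one_mulVec]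
  have hUv : U *ᵥ B⁻¹ *ᵥ v = (1 + (c : ℂ) * s) • v := by
    rw [add_mulVec, hBv, smul_mulVec, vecMulVec_mulVec, ← hs, add_smul, one_smul, mul_smul,
      op_smul_eq_smul]
  have hBU : B⁻¹ *ᵥ v = (1 + (c : ℂ) * s) • U⁻¹ *ᵥ v := by
    rw [← mulVec_smul, ← hUv, mulVec_mulVec (B⁻¹ *ᵥ v) U⁻¹ U,
      nonsing_inv_mul _ ((isUnit_iff_isUnit_det U).mp hU.isUnit), one_mulVec]
  have hst : s = (1 + (c : ℂ) * s) * (star v ⬝ᵥ U⁻¹ *ᵥ v) := by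
    rw [← smul_eq_mul, ← dotProduct_smul, ← hBU]
  have hd : 1 - (c : ℂ) * (star v ⬝ᵥ U⁻¹ *ᵥ v) = (1 + (c : ℂ) * s)⁻¹ := by
    apply eq_inv_of_mul_eq_one_left
    linear_combination (c : ℂ) * hst
  rw [hd, inv_inv]
  exact ⟨inv_pos.mpr h1, hBU⟩

/-- `ΞPΞᴴ` as a sum of rank-one matrices. -/
theorem Matrix.of_mul_diagonal_mul_conjTranspose_eq_sum {m n : Type*} [Fintype n]
    [DecidableEq n] (ξ : n → m → ℂ) (d : n → ℂ) :
    (of fun q k => ξ k q) * diagonal d * (of fun q k => ξ k q)ᴴ =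
      ∑ k, d k • vecMulVec (ξ k) (star (ξ k)) := by
  ext i j
  rw [mul_apply, sum_apply]
  refine Finset.sum_congr rfl fun k _ => ?_
  simp only [mul_diagonal, of_apply, conjTranspose_apply, smul_apply, vecMulVec_apply,
    Pi.star_apply, smul_eq_mul]
  ring

/-- second claim of Lemma 1: the optimal transformation
`a_k⋆ = (Qᵀ⊗Z + Σ_{n≠k} p_n ξ_n ξ_nᴴ)⁻¹ ξ_k` is the positive scalar multiple
`ã_k/(1 − p_k ξ_kᴴΥ⁻¹ξ_k)` of `ã_k = Υ⁻¹ξ_k`, where `Υ = Qᵀ⊗Z + ΞPΞᴴ`. -/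
theorem obe_optimal_transformation_scaled
    (M K : ℕ)
    (Q Z : Matrix (Fin M) (Fin M) ℂ) (hQ : Q.PosDef) (hZ : Z.PosDef)
    (ξ : Fin K → (Fin M × Fin M) → ℂ)
    (Ξ : Matrix (Fin M × Fin M) (Fin K) ℂ) (hΞ : Ξ = Matrix.of fun q k => ξ k q)
    (p : Fin K → ℝ) (hp : ∀ k, 0 < p k)
    (P : Matrix (Fin K) (Fin K) ℂ) (hP : P = Matrix.diagonal fun k => (p k : ℂ))
    (Υ : Matrix (Fin M × Fin M) (Fin M × Fin M) ℂ) (hΥ : Υ = Qᵀ ⊗ₖ Z + Ξ * P * Ξᴴ)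
    (k : Fin K)
    (aopt atil : (Fin M × Fin M) → ℂ)
    (haopt : aopt =
      (Qᵀ ⊗ₖ Z + ∑ n ∈ Finset.univ.erase k, (p n : ℂ) • vecMulVec (ξ n) (star (ξ n)))⁻¹ *ᵥ ξ k)
    (hatil : atil = Υ⁻¹ *ᵥ ξ k) :
    ((1 : ℂ) - (p k : ℂ) * (star (ξ k) ⬝ᵥ Υ⁻¹ *ᵥ ξ k)).im = 0 ∧
    0 < ((1 : ℂ) - (p k : ℂ) * (star (ξ k) ⬝ᵥ Υ⁻¹ *ᵥ ξ k)).re ∧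
    aopt = ((1 : ℂ) - (p k : ℂ) * (star (ξ k) ⬝ᵥ Υ⁻¹ *ᵥ ξ k))⁻¹ • atil := by
  subst hΞ hP
  set B := Qᵀ ⊗ₖ Z + ∑ n ∈ Finset.univ.erase k, (p n : ℂ) • vecMulVec (ξ n) (star (ξ n)) with hBdef
  have hB : B.PosDef := (hQ.transpose.kronecker hZ).add_posSemidef <|
    posSemidef_sum _ fun n _ => (posSemidef_vecMulVec_self_star (ξ n)).smul
      (by exact_mod_cast (hp n).le : (0 : ℂ) ≤ (p n : ℂ))
  have hΥB : Υ = B + (p k : ℂ) • vecMulVec (ξ k) (star (ξ k)) := by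
    rw [hΥ, of_mul_diagonal_mul_conjTranspose_eq_sum, hBdef, add_assoc,
      Finset.sum_erase_add _ _ (Finset.mem_univ k)]
  obtain ⟨hpos, heq⟩ := hB.inv_mulVec_eq_smul_inv_add_vecMulVec (ξ k) (hp k).le
  rw [← hΥB] at hpos heq
  rw [Complex.pos_iff] at hpos
  exact ⟨hpos.2.symm, hpos.1, by rw [haopt, hatil, heq]⟩
end

section
/- Fix K ≥ 1, an index k ∈ {1,…,K}, and p_1,…,p_K > 0 with P = diag(p_1,…,p_K). For each M ∈ ℕ let Γ_M ∈ ℂ^{K×K} be Hermitian positive definite, and assume limsup_{M→∞} ‖Γ_M⁻¹‖₂ < ∞. Define γ⋆(M) = M·p_k · (e_kᵀ Γ_M ((1/M)P⁻¹ + Γ_M)⁻¹ e_k) / (e_kᵀ ((1/M)P⁻¹ + Γ_M)⁻¹ e_k) (a real number) and γ^asy(M) = M·p_k / (e_kᵀ Γ_M⁻¹ e_k) (also real, since e_kᵀΓ_M⁻¹e_k > 0). Then γ⋆(M)/γ^asy(M) → 1 as M → ∞, and liminf_{M→∞} γ^asy(M)/M > 0. -/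
open Matrix Filter
open scoped ComplexOrder

/-- The spectral norm (largest singular value) of a complex matrix. -/
noncomputable def specNorm {m n : Type*} [Fintype m] [Fintype n] [DecidableEq n]
    (A : Matrix m n ℂ) : ℝ :=
  ‖LinearMap.toContinuousLinearMap (Matrix.toEuclideanLin A)‖

open scoped MatrixOrder Matrix.Norms.L2Operator in
theorem Matrix.PosDef.inv_le_inv {n : Type*} [Fintype n] [DecidableEq n] {A B : Matrix n n ℂ}
    (hA : A.PosDef) (hAB : A ≤ B) : B⁻¹ ≤ A⁻¹ := by
  rw [Matrix.nonsing_inv_eq_ringInverse, Matrix.nonsing_inv_eq_ringInverse]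
  exact CStarAlgebra.ringInverse_le_ringInverse hAB hA.isStrictlyPositive

open scoped MatrixOrder in
theorem Matrix.re_diag_le_of_le {n : Type*} {A B : Matrix n n ℂ} (h : A ≤ B) (i : n) :
    (A i i).re ≤ (B i i).re := by
  have h := (Matrix.le_iff.1 h).diag_nonneg (i := i)
  simpa using (Complex.le_def.1 h).1

open scoped MatrixOrder Matrix.Norms.L2Operator in
theorem Matrix.PosDef.le_specNorm_smul_one {n : Type*} [Fintype n] [DecidableEq n]
    {A : Matrix n n ℂ} (hA : A.PosDef) {C : ℝ} (hC : specNorm A ≤ C) :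
    A ≤ C • (1 : Matrix n n ℂ) := by
  have h : A ≤ algebraMap ℝ (Matrix n n ℂ) ‖A‖ :=
    IsSelfAdjoint.le_algebraMap_norm_self hA.isHermitian.isSelfAdjoint
  rw [Algebra.algebraMap_eq_smul_one] at h
  exact h.trans (smul_le_smul_of_nonneg_right hC zero_le_one)

theorem Matrix.inv_real_smul {n : Type*} [Fintype n] [DecidableEq n] {c : ℝ} (hc : c ≠ 0)
    {A : Matrix n n ℂ} (hA : IsUnit A) : (c • A)⁻¹ = c⁻¹ • A⁻¹ := by
  have hdet := (Matrix.isUnit_iff_isUnit_det A).1 hA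
  refine Matrix.inv_eq_left_inv ?_
  rw [smul_mul_smul_comm, Matrix.nonsing_inv_mul _ hdet, inv_mul_cancel₀ hc, one_smul]

open scoped MatrixOrder Matrix.Norms.L2Operator in
/-- A perturbation `E ≤ ε` of `G` changes the inverse by a relative amount of at most `ε * C`,
where `C` bounds the spectral norm of `G⁻¹`. -/
theorem Matrix.PosDef.inv_le_smul_inv_add {n : Type*} [Fintype n] [DecidableEq n]
    {G E : Matrix n n ℂ} (hG : G.PosDef) (hE : E.PosSemidef) {C ε : ℝ} (hC : 0 < C)
    (hGC : specNorm G⁻¹ ≤ C) (hε : 0 ≤ ε) (hEε : E ≤ ε • (1 : Matrix n n ℂ)) :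
    G⁻¹ ≤ (1 + ε * C) • (E + G)⁻¹ := by
  have hc : 0 < 1 + ε * C := by positivity
  have h1 : (1 : Matrix n n ℂ) ≤ C • G := by
    have h := hG.inv.inv_le_inv (hG.inv.le_specNorm_smul_one hGC)
    rw [Matrix.inv_real_smul hC.ne' isUnit_one, inv_one,
      Matrix.nonsing_inv_nonsing_inv _ ((Matrix.isUnit_iff_isUnit_det G).1 hG.isUnit)] at h
    simpa [smul_smul, hC.ne'] using smul_le_smul_of_nonneg_left h hC.le
  have h2 : E + G ≤ (1 + ε * C) • G := by
    have := hEε.trans (smul_le_smul_of_nonneg_left h1 hε)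
    rw [add_smul, one_smul, add_comm, mul_smul]
    gcongr
  have h3 := (Matrix.PosDef.posSemidef_add hE hG).inv_le_inv h2
  rw [Matrix.inv_real_smul hc.ne' hG.isUnit] at h3
  simpa [smul_smul, hc.ne'] using smul_le_smul_of_nonneg_left h3 hc.le

open scoped MatrixOrder in
theorem Matrix.diagonal_ofReal_le_smul_one {n : Type*} [DecidableEq n] {d : n → ℝ} {ε : ℝ}
    (h : ∀ i, d i ≤ ε) :
    Matrix.diagonal (fun i => (d i : ℂ)) ≤ ε • (1 : Matrix n n ℂ) := by
  have : ε • (1 : Matrix n n ℂ) - Matrix.diagonal (fun i => (d i : ℂ)) =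
      Matrix.diagonal (fun i => ((ε - d i : ℝ) : ℂ)) := by
    ext i j
    by_cases hij : i = j <;> simp [hij]
  rw [Matrix.le_iff, this, Matrix.posSemidef_diagonal_iff]
  intro i
  exact Complex.zero_le_real.2 (sub_nonneg.2 (h i))

open scoped MatrixOrder in
/-- Diagonal entries of `G⁻¹` and `(D + G)⁻¹` compared, for a diagonal `D` with entries
in `[0, ε]`. -/
theorem Matrix.PosDef.re_inv_add_diagonal_bounds {n : Type*} [Fintype n] [DecidableEq n]
    {G : Matrix n n ℂ} (hG : G.PosDef) {d : n → ℝ} (hd : ∀ i, 0 ≤ d i) {C ε : ℝ} (hC : 0 < C)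
    (hGC : specNorm G⁻¹ ≤ C) (hdε : ∀ i, d i ≤ ε) (k : n) :
    0 < ((Matrix.diagonal (fun i => (d i : ℂ)) + G)⁻¹ k k).re ∧
    ((Matrix.diagonal (fun i => (d i : ℂ)) + G)⁻¹ k k).re ≤ (G⁻¹ k k).re ∧
    (G⁻¹ k k).re ≤ (1 + ε * C) * ((Matrix.diagonal (fun i => (d i : ℂ)) + G)⁻¹ k k).re ∧
    (G⁻¹ k k).re ≤ C ∧
    ((G * (Matrix.diagonal (fun i => (d i : ℂ)) + G)⁻¹) k k).re =
      1 - d k * ((Matrix.diagonal (fun i => (d i : ℂ)) + G)⁻¹ k k).re := by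
  have hD : (Matrix.diagonal (fun i => (d i : ℂ))).PosSemidef :=
    Matrix.posSemidef_diagonal_iff.2 fun i => Complex.zero_le_real.2 (hd i)
  have hA := Matrix.PosDef.posSemidef_add hD hG
  set D := Matrix.diagonal (fun i => (d i : ℂ)) with hDdef
  refine ⟨(Complex.lt_def.1 hA.inv.diag_pos).1, ?_, ?_, ?_, ?_⟩
  · exact Matrix.re_diag_le_of_le (hG.inv_le_inv (le_add_of_nonneg_left hD.nonneg)) k
  · simpa using Matrix.re_diag_le_of_le (hG.inv_le_smul_inv_add hD hC hGC ((hd k).trans (hdε k))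
      (Matrix.diagonal_ofReal_le_smul_one hdε)) k
  · simpa using Matrix.re_diag_le_of_le (hG.inv.le_specNorm_smul_one hGC) k
  · have h : G * (D + G)⁻¹ = 1 - D * (D + G)⁻¹ := by
      rw [eq_sub_iff_add_eq, add_comm, ← add_mul,
        Matrix.mul_nonsing_inv _ ((Matrix.isUnit_iff_isUnit_det _).1 hA.isUnit)]
    rw [h, Matrix.sub_apply, hDdef, Matrix.diagonal_mul]
    simp

/-- Theorem 2: if `limsup ‖Γ_M⁻¹‖₂ < ∞` then the reformulated optimal SINR
`γ⋆(M)` is asymptotically equivalent to `γ^asy(M) = M p_k/(e_kᵀΓ_M⁻¹e_k)`, which grows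
linearly in `M`. -/
theorem obe_asymptotic_sinr
    (K : ℕ) (hK : 1 ≤ K) (k : Fin K)
    (p : Fin K → ℝ) (hp : ∀ n, 0 < p n)
    (P : Matrix (Fin K) (Fin K) ℂ) (hP : P = Matrix.diagonal fun n => (p n : ℂ))
    (Γ : ℕ → Matrix (Fin K) (Fin K) ℂ) (hΓ : ∀ M, (Γ M).PosDef)
    (hbound : Filter.limsup (fun M : ℕ => ((specNorm (Γ M)⁻¹ : ℝ) : EReal)) Filter.atTop < ⊤)
    (γstar γasy : ℕ → ℝ)
    (hγstar : ∀ M : ℕ, γstar M =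
      M * p k * (((Γ M) * (((1 : ℂ) / M) • P⁻¹ + Γ M)⁻¹) k k).re /
        (((((1 : ℂ) / M) • P⁻¹ + Γ M)⁻¹) k k).re)
    (hγasy : ∀ M : ℕ, γasy M = M * p k / (((Γ M)⁻¹) k k).re) :
    Filter.Tendsto (fun M : ℕ => γstar M / γasy M) Filter.atTop (nhds 1) ∧
    0 < Filter.liminf (fun M : ℕ => ((γasy M / M : ℝ) : EReal)) Filter.atTop := by
  obtain ⟨C, hC, hev⟩ : ∃ C : ℝ, 0 < C ∧ ∀ᶠ M in atTop, specNorm (Γ M)⁻¹ ≤ C := by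
    obtain ⟨c, hc, -⟩ := EReal.lt_iff_exists_real_btwn.1 hbound
    refine ⟨max c 1, by positivity, ?_⟩
    filter_upwards [eventually_lt_of_limsup_lt hc] with M hM
    exact (EReal.coe_lt_coe_iff.1 hM).le.trans (le_max_left _ _)
  have hpk := hp k
  have hPinv : ∀ M : ℕ, ((1 : ℂ) / M) • P⁻¹ =
      Matrix.diagonal fun n => (((1 / M) * (p n)⁻¹ : ℝ) : ℂ) := by
    intro M
    have : P⁻¹ = Matrix.diagonal fun n => ((p n : ℂ))⁻¹ := by
      refine Matrix.inv_eq_left_inv ?_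
      rw [hP, Matrix.diagonal_mul_diagonal, ← Matrix.diagonal_one]
      congr 1
      ext n
      exact inv_mul_cancel₀ (Complex.ofReal_ne_zero.2 (hp n).ne')
    rw [this, ← Matrix.diagonal_smul]
    congr 1
    ext n
    simp
  set δ : ℝ := ∑ n, (p n)⁻¹
  have hδ : ∀ n, (p n)⁻¹ ≤ δ := fun n =>
    Finset.single_le_sum (f := fun n => (p n)⁻¹) (fun i _ => (inv_pos.2 (hp i)).le)
      (Finset.mem_univ n)
  have hbounds := fun (M : ℕ) (hM : specNorm (Γ M)⁻¹ ≤ C) =>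
    (hΓ M).re_inv_add_diagonal_bounds (d := fun n => 1 / M * (p n)⁻¹)
      (fun n => mul_nonneg (by positivity) (inv_pos.2 (hp n)).le) hC hM (ε := 1 / M * δ)
      (fun n => mul_le_mul_of_nonneg_left (hδ n) (by positivity)) k
  simp only [← hPinv] at hbounds
  constructor
  · set a : ℕ → ℝ := fun M => ((((1 : ℂ) / M) • P⁻¹ + Γ M)⁻¹ k k).re
    set b : ℕ → ℝ := fun M => ((Γ M)⁻¹ k k).re
    have ht : Tendsto (fun M : ℕ => (1 : ℝ) / M) atTop (nhds 0) :=
      tendsto_one_div_atTop_nhds_zero_nat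
    have h1 : Tendsto (fun M : ℕ => 1 - 1 / M * (p k)⁻¹ * a M) atTop (nhds 1) := by
      have hlow : Tendsto (fun M : ℕ => 1 - (1 : ℝ) / M * (p k)⁻¹ * C) atTop (nhds 1) := by
        simpa using ((ht.mul_const (p k)⁻¹).mul_const C).const_sub 1
      refine tendsto_of_tendsto_of_tendsto_of_le_of_le' hlow tendsto_const_nhds ?_ ?_
      · filter_upwards [hev] with M hM
        obtain ⟨-, hab, -, hbC, -⟩ := hbounds M hM
        exact sub_le_sub_left (mul_le_mul_of_nonneg_left (hab.trans hbC) (by positivity)) _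
      · filter_upwards [hev] with M hM
        have ha : 0 < a M := (hbounds M hM).1
        exact sub_le_self _ (by positivity)
    have h2 : Tendsto (fun M : ℕ => b M / a M) atTop (nhds 1) := by
      have hup : Tendsto (fun M : ℕ => 1 + (1 : ℝ) / M * δ * C) atTop (nhds 1) := by
        simpa using ((ht.mul_const δ).mul_const C).const_add 1
      refine tendsto_of_tendsto_of_tendsto_of_le_of_le' tendsto_const_nhds hup ?_ ?_
      · filter_upwards [hev] with M hM
        obtain ⟨ha, hab, -⟩ := hbounds M hM
        exact (one_le_div ha).2 hab
      · filter_upwards [hev] with M hM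
        obtain ⟨ha, -, hba, -⟩ := hbounds M hM
        exact (div_le_iff₀ ha).2 hba
    have h12 := h1.mul h2
    rw [one_mul] at h12
    refine h12.congr' ?_
    filter_upwards [hev, eventually_gt_atTop 0] with M hM hM0
    obtain ⟨ha, hab, -, -, heq⟩ := hbounds M hM
    have hM0 : (0 : ℝ) < M := Nat.cast_pos.2 hM0
    have ha : 0 < a M := ha
    have hb : 0 < b M := ha.trans_le hab
    rw [hγstar, hγasy, heq]
    change (1 - 1 / M * (p k)⁻¹ * a M) * (b M / a M) =
      M * p k * (1 - 1 / M * (p k)⁻¹ * a M) / a M / (M * p k / b M)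
    field_simp
  · have hpos : (0 : EReal) < ((p k / C : ℝ) : EReal) := EReal.coe_pos.2 (div_pos hpk hC)
    refine hpos.trans_le (le_liminf_of_le (by isBoundedDefault) ?_)
    filter_upwards [hev, eventually_gt_atTop 0] with M hM hM0
    obtain ⟨ha, hab, -, hbC, -⟩ := hbounds M hM
    have hM0 : (0 : ℝ) < M := Nat.cast_pos.2 hM0
    rw [hγasy, EReal.coe_le_coe_iff, div_right_comm, mul_div_cancel_left₀ _ hM0.ne']
    exact div_le_div_of_nonneg_left hpk.le (ha.trans_le hab) hbC
end

section
/- Fix K ≥ 1, a nonempty subset S ⊆ {1,…,K}, and constants p_1,…,p_K > 0 and p_tr > 0. For each M ∈ ℕ, let C_1(M),…,C_K(M) ∈ ℂ^{M×M} be Hermitian positive semidefinite, and set Z_M = I + Σ_{n=1}^K p_n C_n(M), Q_M = (1/p_tr)·I + Σ_{n∈S} C_n(M), and let Ξ_M ∈ ℂ^{M²×|S|} have columns vec(C_k(M)) for k ∈ S, and Γ_M = (1/M)·Ξ_Mᴴ((Q_Mᵀ)⁻¹⊗Z_M⁻¹)Ξ_M. Assume: (Condition 2) liminf_{M→∞}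 min_{λ∈ℂ^{|S|}, ‖λ‖₂=1} (1/M)·‖Σ_{k∈S} λ_k C_k(M)‖_F² > 0; and (Condition 3) limsup_{M→∞} ‖C_k(M)‖₂ < ∞ for every k ∈ {1,…,K}. Then limsup_{M→∞} ‖Γ_M⁻¹‖₂ < ∞ (in particular Γ_M is invertible for all sufficiently large M). -/
open Matrix Filter
open scoped Kronecker ComplexOrder

/-- The Frobenius norm of a complex matrix. -/
noncomputable def frobNorm {m n : Type*} [Fintype m] [Fintype n] (A : Matrix m n ℂ) : ℝ :=
  Real.sqrt (∑ i, ∑ j, ‖A i j‖ ^ 2)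

theorem Matrix.re_inner_toEuclideanLin_smul_one {n : Type*} [Fintype n] [DecidableEq n]
    (b : ℝ) (x : EuclideanSpace ℂ n) :
    RCLike.re (inner ℂ (toEuclideanLin ((b : ℂ) • (1 : Matrix n n ℂ)) x) x) = b * ‖x‖ ^ 2 := by
  have : toEuclideanLin ((b : ℂ) • (1 : Matrix n n ℂ)) x = (b : ℂ) • x := by
    ext i; simp [toLpLin_apply, smul_mulVec]
  rw [this, inner_smul_left, inner_self_eq_norm_sq_to_K]
  simp [← Complex.ofReal_pow]

theorem Matrix.posSemidef_smul_one_sub_of_specNorm_le {n : Type*} [Fintype n] [DecidableEq n]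
    {A : Matrix n n ℂ} (hA : A.IsHermitian) {b : ℝ} (hb : specNorm A ≤ b) :
    ((b : ℂ) • (1 : Matrix n n ℂ) - A).PosSemidef := by
  rw [← isPositive_toEuclideanLin_iff]
  refine ⟨?_, fun x ↦ ?_⟩
  · rw [isSymmetric_toEuclideanLin_iff]
    exact (IsHermitian.ext fun i j ↦ by by_cases h : i = j <;> simp [h, Ne.symm]).sub hA
  · have hle : ‖toEuclideanLin A x‖ ≤ b * ‖x‖ :=
      ((LinearMap.toContinuousLinearMap (toEuclideanLin A)).le_opNorm x).trans
        (mul_le_mul_of_nonneg_right hb (norm_nonneg x))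
    have hre := (RCLike.re_le_norm _).trans (norm_inner_le_norm (𝕜 := ℂ) (toEuclideanLin A x) x)
    rw [map_sub, LinearMap.sub_apply, inner_sub_left, map_sub, re_inner_toEuclideanLin_smul_one]
    nlinarith [norm_nonneg x]

theorem Matrix.specNorm_inv_le {n : Type*} [Fintype n] [DecidableEq n]
    {G : Matrix n n ℂ} {g : ℝ} (hg : 0 < g) (hunit : IsUnit G)
    (hG : (G - (g : ℂ) • (1 : Matrix n n ℂ)).PosSemidef) :
    specNorm G⁻¹ ≤ g⁻¹ := by
  refine ContinuousLinearMap.opNorm_le_bound _ (inv_nonneg.mpr hg.le) fun y ↦ ?_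
  change ‖toEuclideanLin G⁻¹ y‖ ≤ _
  set x := toEuclideanLin G⁻¹ y with hx
  have hy : toEuclideanLin G x = y := by
    ext i
    simp [hx, toLpLin_apply, mulVec_mulVec,
      mul_nonsing_inv _ ((isUnit_iff_isUnit_det G).mp hunit)]
  have hpos := (isPositive_toEuclideanLin_iff.mpr hG).2 x
  rw [map_sub, LinearMap.sub_apply, inner_sub_left, map_sub,
    re_inner_toEuclideanLin_smul_one, hy] at hpos
  have hre := (RCLike.re_le_norm _).trans (norm_inner_le_norm (𝕜 := ℂ) y x)
  rw [inv_mul_eq_div, le_div_iff₀ hg]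
  rcases (norm_nonneg x).eq_or_lt with h0 | h0
  · rw [← h0]; simp
  · nlinarith

theorem Matrix.PosDef.of_sub_smul_one {n : Type*} [Fintype n] [DecidableEq n]
    {G : Matrix n n ℂ} {g : ℝ} (hg : 0 < g)
    (hG : (G - (g : ℂ) • (1 : Matrix n n ℂ)).PosSemidef) : G.PosDef := by
  have h := PosDef.posSemidef_add hG
    ((PosDef.one (n := n) (R := ℂ)).smul (a := (g : ℂ)) (by exact_mod_cast hg))
  simpa using h

theorem Matrix.PosDef.inv_sub_smul_one_posSemidef {n : Type*} [Fintype n] [DecidableEq n]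
    {A : Matrix n n ℂ} (hA : A.PosDef) {a : ℝ} (ha : 0 < a)
    (h : ((a : ℂ) • (1 : Matrix n n ℂ) - A).PosSemidef) :
    (A⁻¹ - ((a⁻¹ : ℝ) : ℂ) • (1 : Matrix n n ℂ)).PosSemidef := by
  have hdet := (isUnit_iff_isUnit_det A).mp hA.isUnit
  have h2 := (h.add (hA.inv.posSemidef.conjTranspose_mul_mul_same
    ((a : ℂ) • (1 : Matrix n n ℂ) - A))).smul (a := (((a⁻¹) ^ 2 : ℝ) : ℂ))
      (by exact_mod_cast sq_nonneg a⁻¹)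
  rw [h.isHermitian.eq] at h2
  convert h2 using 1
  have e : (a : ℂ) ≠ 0 := by exact_mod_cast ha.ne'
  have : ((a : ℂ) • (1 : Matrix n n ℂ) - A) * A⁻¹ * ((a : ℂ) • (1 : Matrix n n ℂ) - A)
      = ((a : ℂ) ^ 2) • A⁻¹ - (2 * (a : ℂ)) • 1 + A := by
    simp only [sub_mul, mul_sub, smul_mul_assoc, mul_smul_comm, one_mul, mul_one,
      mul_nonsing_inv _ hdet, nonsing_inv_mul _ hdet]
    module
  rw [this]
  push_cast
  match_scalars <;> field_simp <;> ring

theorem Matrix.PosSemidef.kronecker_sub_smul_one {m n : Type*} [Fintype m] [Fintype n]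
    [DecidableEq m] [DecidableEq n] {A : Matrix m m ℂ} {B : Matrix n n ℂ} {a b : ℝ} (ha : 0 ≤ a)
    (hB : B.PosSemidef) (hAa : (A - (a : ℂ) • (1 : Matrix m m ℂ)).PosSemidef)
    (hBb : (B - (b : ℂ) • (1 : Matrix n n ℂ)).PosSemidef) :
    (A ⊗ₖ B - ((a * b : ℝ) : ℂ) • (1 : Matrix (m × n) (m × n) ℂ)).PosSemidef := by
  have h := (hAa.kronecker hB).add
    (((PosSemidef.one (n := m) (R := ℂ)).kronecker hBb).smul (a := (a : ℂ))
      (by exact_mod_cast ha))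
  have e1 : (A - (a : ℂ) • (1 : Matrix m m ℂ)) ⊗ₖ B = A ⊗ₖ B - (a : ℂ) • (1 ⊗ₖ B) := by
    ext i j; simp [kroneckerMap_apply]; ring
  have e2 : (1 : Matrix m m ℂ) ⊗ₖ (B - (b : ℂ) • (1 : Matrix n n ℂ))
      = 1 ⊗ₖ B - (b : ℂ) • 1 := by
    rw [← one_kronecker_one]
    ext i j; simp only [kroneckerMap_apply, sub_apply, smul_apply, smul_eq_mul]; ring
  rw [e1, e2] at h
  convert! h using 1
  push_cast
  module

theorem frobNorm_sq {m n : Type*} [Fintype m] [Fintype n] (A : Matrix m n ℂ) :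
    frobNorm A ^ 2 = ∑ i, ∑ j, ‖A i j‖ ^ 2 :=
  Real.sq_sqrt (by positivity)

theorem frobNorm_sq_smul {m n : Type*} [Fintype m] [Fintype n] (c : ℂ) (A : Matrix m n ℂ) :
    frobNorm (c • A) ^ 2 = ‖c‖ ^ 2 * frobNorm A ^ 2 := by
  simp [frobNorm_sq, mul_pow, Finset.mul_sum]

theorem le_frobNorm_sq_of_lt_iInf_sphere {ι m n : Type*} [Fintype ι] [Fintype m] [Fintype n]
    (C : ι → Matrix m n ℂ) {r δ : ℝ} (hr : 0 ≤ r)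
    (h : δ < ⨅ lam : Metric.sphere (0 : EuclideanSpace ℂ ι) 1,
      r * frobNorm (∑ k, ((lam : EuclideanSpace ℂ ι) k) • C k) ^ 2)
    (x : EuclideanSpace ℂ ι) :
    δ * ‖x‖ ^ 2 ≤ r * frobNorm (∑ k, x k • C k) ^ 2 := by
  rcases eq_or_ne x 0 with rfl | hx
  · simpa using mul_nonneg hr (sq_nonneg _)
  have hx0 : (‖x‖ : ℂ) ≠ 0 := by exact_mod_cast norm_ne_zero_iff.mpr hx
  have hbdd : BddBelow (Set.range fun lam : Metric.sphere (0 : EuclideanSpace ℂ ι) 1 ↦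
      r * frobNorm (∑ k, ((lam : EuclideanSpace ℂ ι) k) • C k) ^ 2) :=
    ⟨0, by rintro _ ⟨l, rfl⟩; positivity⟩
  have hle := h.le.trans (ciInf_le hbdd ⟨((‖x‖ : ℂ)⁻¹) • x, by simp [norm_smul, hx]⟩)
  have hsum : ∑ k, x k • C k = (‖x‖ : ℂ) • ∑ k, (((‖x‖ : ℂ)⁻¹) • x) k • C k := by
    simp [Finset.smul_sum, smul_smul, hx0]
  rw [hsum, frobNorm_sq_smul]
  simp only [Complex.norm_real, norm_norm]
  nlinarith [sq_nonneg ‖x‖]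

theorem Filter.exists_pos_eventually_lt_of_pos_liminf {u : ℕ → ℝ}
    (h : 0 < liminf (fun M ↦ (u M : EReal)) atTop) : ∃ δ > 0, ∀ᶠ M in atTop, δ < u M := by
  obtain ⟨δ, h0, hδ⟩ := EReal.lt_iff_exists_real_btwn.mp h
  exact ⟨δ, by exact_mod_cast h0,
    (eventually_lt_of_lt_liminf hδ).mono fun M hM ↦ by exact_mod_cast hM⟩

theorem Filter.exists_eventually_le_of_limsup_lt_top {u : ℕ → ℝ}
    (h : limsup (fun M ↦ (u M : EReal)) atTop < ⊤) : ∃ b, 0 ≤ b ∧ ∀ᶠ M in atTop, u M ≤ b := by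
  obtain ⟨b, hb, -⟩ := EReal.lt_iff_exists_real_btwn.mp h
  exact ⟨max b 0, le_max_right _ _, (eventually_lt_of_limsup_lt hb).mono fun M hM ↦
    (show u M ≤ b by exact_mod_cast hM.le).trans (le_max_left _ _)⟩

theorem Matrix.smul_one_sub_sum_posSemidef {n ι : Type*} [Fintype n] [DecidableEq n]
    (s : Finset ι) {A : ι → Matrix n n ℂ} {w b : ι → ℝ} (hw : ∀ i, 0 ≤ w i)
    (h : ∀ i, ((b i : ℂ) • (1 : Matrix n n ℂ) - A i).PosSemidef) (t : ℝ) :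
    (((t + ∑ i ∈ s, w i * b i : ℝ) : ℂ) • (1 : Matrix n n ℂ)
      - ((t : ℂ) • 1 + ∑ i ∈ s, (w i : ℂ) • A i)).PosSemidef := by
  have := posSemidef_sum s fun i _ ↦ (h i).smul (a := (w i : ℂ)) (by exact_mod_cast hw i)
  convert this using 1
  push_cast
  simp only [smul_sub, smul_smul, Finset.sum_sub_distrib, ← Finset.sum_smul]
  module

theorem star_dotProduct_self_eq_sum_norm_sq {κ : Type*} [Fintype κ] (v : κ → ℂ) :
    star v ⬝ᵥ v = ((∑ i, ‖v i‖ ^ 2 : ℝ) : ℂ) := by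
  simp [dotProduct, Complex.conj_mul']

theorem Matrix.gram_vec_sub_smul_one_posSemidef {ι m n : Type*} [Fintype ι] [DecidableEq ι]
    [Fintype m] [Fintype n] (C : ι → Matrix m n ℂ) {r δ : ℝ}
    (h : ∀ x : EuclideanSpace ℂ ι, δ * ‖x‖ ^ 2 ≤ r * frobNorm (∑ k, x k • C k) ^ 2)
    {V : Matrix (n × m) ι ℂ} (hV : V = of fun q k ↦ C k q.2 q.1) :
    ((r : ℂ) • (Vᴴ * V) - (δ : ℂ) • (1 : Matrix ι ι ℂ)).PosSemidef := by
  refine PosSemidef.of_dotProduct_mulVec_nonneg ?_ fun x ↦ ?_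
  · simp [IsHermitian, conjTranspose_sub, conjTranspose_smul]
  · have hfrob : ∑ q, ‖(V *ᵥ x) q‖ ^ 2 = frobNorm (∑ k, x k • C k) ^ 2 := by
      rw [frobNorm_sq, Fintype.sum_prod_type, Finset.sum_comm]
      refine Finset.sum_congr rfl fun i _ ↦ Finset.sum_congr rfl fun j _ ↦ ?_
      simp [hV, mulVec, dotProduct, sum_apply, mul_comm]
    have hx := h (WithLp.toLp 2 x)
    rw [EuclideanSpace.norm_sq_eq] at hx
    rw [sub_mulVec, smul_mulVec, smul_mulVec, one_mulVec, dotProduct_sub, dotProduct_smul,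
      dotProduct_smul, ← mulVec_mulVec, dotProduct_mulVec, ← star_mulVec, star_dotProduct_self_eq_sum_norm_sq,
      star_dotProduct_self_eq_sum_norm_sq, hfrob,
      smul_eq_mul, smul_eq_mul, sub_nonneg]
    exact_mod_cast hx

/-- Lemma 3: under asymptotic linear independence (Condition 2) and bounded
spectral norms (Condition 3) of the covariance matrices, `limsup ‖Γ_M⁻¹‖₂ < ∞`. -/
theorem obe_gamma_inverse_asymptotically_bounded
    (K : ℕ) (hK : 1 ≤ K) (S : Finset (Fin K)) (hS : S.Nonempty)
    (p : Fin K → ℝ) (hp : ∀ n, 0 < p n) (ptr : ℝ) (hptr : 0 < ptr)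
    (C : (M : ℕ) → Fin K → Matrix (Fin M) (Fin M) ℂ)
    (hC : ∀ M n, (C M n).PosSemidef)
    (Z : (M : ℕ) → Matrix (Fin M) (Fin M) ℂ)
    (hZ : ∀ M, Z M = 1 + ∑ n, (p n : ℂ) • C M n)
    (Q : (M : ℕ) → Matrix (Fin M) (Fin M) ℂ)
    (hQ : ∀ M, Q M = ((1 : ℂ) / ptr) • 1 + ∑ n ∈ S, C M n)
    (Ξ : (M : ℕ) → Matrix (Fin M × Fin M) S ℂ)
    (hΞ : ∀ M, Ξ M = Matrix.of fun q (n : S) => C M n q.2 q.1)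
    (Γ : (M : ℕ) → Matrix S S ℂ)
    (hΓ : ∀ M, Γ M = ((1 : ℂ) / M) • ((Ξ M)ᴴ * (((Q M)ᵀ)⁻¹ ⊗ₖ (Z M)⁻¹) * Ξ M))
    (hcond2 : 0 < Filter.liminf (fun M : ℕ =>
      ((⨅ lam : Metric.sphere (0 : EuclideanSpace ℂ S) 1,
          (1 / M : ℝ) * frobNorm (∑ n : S, ((lam : EuclideanSpace ℂ S) n) • C M n) ^ 2
        : ℝ) : EReal)) Filter.atTop)
    (hcond3 : ∀ n : Fin K,
      Filter.limsup (fun M : ℕ => ((specNorm (C M n) : ℝ) : EReal)) Filter.atTop < ⊤) :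
    Filter.limsup (fun M : ℕ => ((specNorm (Γ M)⁻¹ : ℝ) : EReal)) Filter.atTop < ⊤ ∧
    ∀ᶠ M : ℕ in Filter.atTop, IsUnit (Γ M) := by
  obtain ⟨δ, hδ, hδM⟩ := exists_pos_eventually_lt_of_pos_liminf hcond2
  choose b hb hbM using fun n ↦ exists_eventually_le_of_limsup_lt_top (hcond3 n)
  set z : ℝ := 1 + ∑ n, p n * b n with hz
  set q : ℝ := 1 / ptr + ∑ n ∈ S, 1 * b n with hq
  have hz0 : 0 < z := by
    have := Finset.sum_nonneg fun n (_ : n ∈ Finset.univ) ↦ mul_nonneg (hp n).le (hb n)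
    linarith
  have hq0 : 0 < q := by
    have := Finset.sum_nonneg fun n (_ : n ∈ S) ↦ mul_nonneg zero_le_one (hb n)
    have : 0 < 1 / ptr := by positivity
    linarith
  set c : ℝ := q⁻¹ * z⁻¹ with hc
  have hc0 : 0 < c := by positivity
  have key : ∀ᶠ M in atTop,
      (Γ M - ((c * δ : ℝ) : ℂ) • (1 : Matrix S S ℂ)).PosSemidef := by
    filter_upwards [hδM, eventually_all.mpr hbM] with M hM hbM
    have hle n := posSemidef_smul_one_sub_of_specNorm_le (hC M n).isHermitian (hbM n)
    have hZle : ((z : ℂ) • 1 - Z M).PosSemidef := by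
      simpa [hZ, hz] using smul_one_sub_sum_posSemidef Finset.univ (fun n ↦ (hp n).le) hle 1
    have hQle : ((q : ℂ) • 1 - Q M).PosSemidef := by
      simpa [hQ, hq] using
        smul_one_sub_sum_posSemidef S (w := fun _ ↦ 1) (fun _ ↦ zero_le_one) hle (1 / ptr)
    have hZpos : (Z M).PosDef := by
      rw [hZ]
      exact PosDef.one.add_posSemidef (posSemidef_sum _ fun n _ ↦
        (hC M n).smul (by exact_mod_cast (hp n).le))
    have hQpos : (Q M).PosDef := by
      rw [hQ]
      refine (PosDef.one.smul ?_).add_posSemidef (posSemidef_sum _ fun n _ ↦ hC M n)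
      exact_mod_cast one_div_pos.mpr hptr
    have hW := PosSemidef.kronecker_sub_smul_one (inv_nonneg.mpr hq0.le) hZpos.inv.posSemidef
      (hQpos.transpose.inv_sub_smul_one_posSemidef hq0 (by simpa using hQle.transpose))
      (hZpos.inv_sub_smul_one_posSemidef hz0 hZle)
    rw [← hc] at hW
    have hr : (0 : ℝ) ≤ 1 / M := by positivity
    have hgram := gram_vec_sub_smul_one_posSemidef (fun k : S ↦ C M k)
      (le_frobNorm_sq_of_lt_iInf_sphere _ hr hM) (hΞ M)
    have hsum := ((hW.conjTranspose_mul_mul_same (Ξ M)).smul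
      (a := ((1 / M : ℝ) : ℂ)) (by exact_mod_cast hr)).add
      (hgram.smul (a := (c : ℂ)) (by exact_mod_cast hc0.le))
    convert! hsum using 1
    rw [hΓ]
    simp only [Matrix.mul_sub, Matrix.sub_mul, Matrix.mul_smul, 
      Matrix.smul_mul, Matrix.mul_one]
    push_cast
    module
  refine ⟨?_, key.mono fun M hM ↦ (PosDef.of_sub_smul_one (by positivity) hM).isUnit⟩
  refine (limsup_le_of_le (a := (((c * δ)⁻¹ : ℝ) : EReal)) ?_ ?_).trans_lt (EReal.coe_lt_top _)
  · isBoundedDefault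
  · filter_upwards [key] with M hM
    exact_mod_cast specNorm_inv_le (by positivity)
      (PosDef.of_sub_smul_one (by positivity) hM).isUnit hM
end

section
/- Let Z̃ ∈ ℂ^{M×M} be Hermitian positive definite, let ĥ_1,…,ĥ_K ∈ ℂ^M be the columns of Ĥ ∈ ℂ^{M×K}, let p_1,…,p_K > 0, P = diag(p_1,…,p_K), and define the Hermitian positive semidefinite matrix Γ = (1/M)·Ĥᴴ Z̃⁻¹ Ĥ ∈ ℂ^{K×K}. Then for every k the matrix Z̃ + Σ_{n≠k} p_n ĥ_n ĥ_nᴴ is invertible and p_k · ĥ_kᴴ (Z̃ + Σ_{n≠k} p_n ĥ_n ĥ_nᴴ)⁻¹ ĥ_k = M·p_k · (e_kᵀ Γ ((1/M)P⁻¹ + Γ)⁻¹ e_k) / (e_kᵀ ((1/M)P⁻¹ + Γ)⁻¹ e_k), where both sides are real and the denominator on the right is positive. -/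
open Matrix
open scoped ComplexOrder

/-- A positive definite matrix plus a nonnegative combination of rank-one matrices `h hᴴ`
is positive definite. -/
theorem posDef_add_sum_vecMulVec {m ι : Type*} [Fintype m] {Z : Matrix m m ℂ} (hZ : Z.PosDef)
    (s : Finset ι) (h : ι → m → ℂ) {p : ι → ℝ} (hp : ∀ i, 0 ≤ p i) :
    (Z + ∑ i ∈ s, (p i : ℂ) • vecMulVec (h i) (star (h i))).PosDef :=
  hZ.add_posSemidef <| Matrix.posSemidef_sum s fun i _ =>
    (posSemidef_vecMulVec_self_star (h i)).smul (Complex.zero_le_real.mpr (hp i))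

/-- The sum of the rank-one matrices built from the columns of `H`, applied to a vector. -/
theorem sum_smul_vecMulVec_mulVec {m ι : Type*} [Fintype m] [Fintype ι] [DecidableEq ι]
    (h : ι → m → ℂ) (p : ι → ℂ) (v : m → ℂ) :
    (∑ i, p i • vecMulVec (h i) (star (h i))) *ᵥ v =
      (Matrix.of fun a i => h i a) *ᵥ fun i => p i * (star (h i) ⬝ᵥ v) := by
  rw [Matrix.sum_mulVec]
  ext a
  simp only [Finset.sum_apply, smul_mulVec, vecMulVec_mulVec, Pi.smul_apply, mulVec,
    dotProduct, of_apply, smul_eq_mul, MulOpposite.smul_eq_mul_unop, MulOpposite.unop_op]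
  exact Finset.sum_congr rfl fun i _ => by ring

/-- reformulation (66) in Appendix C: the optimal LMMSE-filter SINR
`p_k ĥ_kᴴ(Z̃ + Σ_{n≠k} p_n ĥ_n ĥ_nᴴ)⁻¹ĥ_k` equals
`M p_k (e_kᵀ Γ ((1/M)P⁻¹+Γ)⁻¹ e_k)/(e_kᵀ ((1/M)P⁻¹+Γ)⁻¹ e_k)` with `Γ = (1/M)ĤᴴZ̃⁻¹Ĥ`. -/
theorem lmmse_sinr_reformulation
    (M K : ℕ) (hM : 0 < M)
    (Ztil : Matrix (Fin M) (Fin M) ℂ) (hZtil : Ztil.PosDef)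
    (hhat : Fin K → Fin M → ℂ)
    (Hhat : Matrix (Fin M) (Fin K) ℂ) (hHhat : Hhat = Matrix.of fun m k => hhat k m)
    (p : Fin K → ℝ) (hp : ∀ k, 0 < p k)
    (P : Matrix (Fin K) (Fin K) ℂ) (hP : P = Matrix.diagonal fun k => (p k : ℂ))
    (Γ : Matrix (Fin K) (Fin K) ℂ)
    (hΓ : Γ = ((1 : ℂ) / M) • (Hhatᴴ * Ztil⁻¹ * Hhat))
    (k : Fin K) :
    IsUnit (Ztil + ∑ n ∈ Finset.univ.erase k, (p n : ℂ) • vecMulVec (hhat n) (star (hhat n))) ∧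
    ((Γ * (((1 : ℂ) / M) • P⁻¹ + Γ)⁻¹) k k).im = 0 ∧
    (((((1 : ℂ) / M) • P⁻¹ + Γ)⁻¹) k k).im = 0 ∧
    0 < (((((1 : ℂ) / M) • P⁻¹ + Γ)⁻¹) k k).re ∧
    ((p k : ℂ) * (star (hhat k) ⬝ᵥ
        (Ztil + ∑ n ∈ Finset.univ.erase k, (p n : ℂ) • vecMulVec (hhat n) (star (hhat n)))⁻¹
          *ᵥ hhat k)).im = 0 ∧
    (p k : ℂ) * (star (hhat k) ⬝ᵥ
        (Ztil + ∑ n ∈ Finset.univ.erase k, (p n : ℂ) • vecMulVec (hhat n) (star (hhat n)))⁻¹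
          *ᵥ hhat k) =
      (M : ℂ) * (p k : ℂ) * ((Γ * (((1 : ℂ) / M) • P⁻¹ + Γ)⁻¹) k k) /
        (((((1 : ℂ) / M) • P⁻¹ + Γ)⁻¹) k k) := by
  have hMC : (M : ℂ) ≠ 0 := by exact_mod_cast hM.ne'
  have hpC : ∀ n, (p n : ℂ) ≠ 0 := fun n => by exact_mod_cast (hp n).ne'
  have hD : ((1 : ℂ) / M) • P⁻¹ = Matrix.diagonal fun n => ((M * p n)⁻¹ : ℂ) := by
    have hPinv : P⁻¹ = Matrix.diagonal fun n => ((p n : ℂ))⁻¹ := by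
      refine Matrix.inv_eq_right_inv ?_
      rw [hP, Matrix.diagonal_mul_diagonal, ← Matrix.diagonal_one]
      exact congrArg _ (funext fun n => mul_inv_cancel₀ (hpC n))
    rw [hPinv, ← Matrix.diagonal_smul]
    congr 1
    ext n
    simp [mul_comm]
  rw [hD]
  set D : Matrix (Fin K) (Fin K) ℂ := Matrix.diagonal fun n => ((M * p n)⁻¹ : ℂ) with hDdef
  have hDpos : D.PosDef := Matrix.PosDef.diagonal fun n => by
    have h : (0 : ℝ) < (M * p n)⁻¹ := inv_pos.mpr (mul_pos (Nat.cast_pos.mpr hM) (hp n))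
    exact_mod_cast Complex.zero_lt_real.mpr h
  have hΓpos : Γ.PosSemidef := by
    rw [hΓ]
    refine (hZtil.inv.posSemidef.conjTranspose_mul_mul_same Hhat).smul ?_
    positivity
  have hQ : (D + Γ).PosDef := hDpos.add_posSemidef hΓpos
  have hQu : IsUnit (D + Γ).det := (Matrix.isUnit_iff_isUnit_det _).mp hQ.isUnit
  have hZu : IsUnit Ztil.det := (Matrix.isUnit_iff_isUnit_det _).mp hZtil.isUnit
  have hA := posDef_add_sum_vecMulVec hZtil (Finset.univ.erase k) hhat fun n => (hp n).le
  set A := Ztil + ∑ n ∈ Finset.univ.erase k, (p n : ℂ) • vecMulVec (hhat n) (star (hhat n))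
    with hAdef
  have hAu : IsUnit A.det := (Matrix.isUnit_iff_isUnit_det _).mp hA.isUnit
  have hq : 0 < (D + Γ)⁻¹ k k := hQ.inv.diag_pos
  have hnum : (Γ * (D + Γ)⁻¹) k k = 1 - (M * p k : ℂ)⁻¹ * (D + Γ)⁻¹ k k := by
    have h : Γ * (D + Γ)⁻¹ = 1 - D * (D + Γ)⁻¹ := by
      rw [eq_sub_iff_add_eq', ← add_mul, Matrix.mul_nonsing_inv _ hQu]
    rw [h, hDdef, Matrix.sub_apply, Matrix.one_apply_eq, Matrix.diagonal_mul]
  set q := (D + Γ)⁻¹ k k with hqdef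
  set v := A⁻¹ *ᵥ hhat k with hv
  set s := star (hhat k) ⬝ᵥ v with hs
  have hs_nonneg : 0 ≤ s := hA.inv.posSemidef.dotProduct_mulVec_nonneg (hhat k)
  have hAv : A *ᵥ v = hhat k := by
    rw [hv, Matrix.mulVec_mulVec, Matrix.mul_nonsing_inv _ hAu, Matrix.one_mulVec]
  set w : Fin K → ℂ := fun n => p n * (star (hhat n) ⬝ᵥ v) with hw
  set c : ℂ := 1 + p k * s with hc
  have hZv : Ztil *ᵥ v = Hhat *ᵥ (c • Pi.single k 1 - w) := by
    have h1 : Ztil *ᵥ v + Hhat *ᵥ w = c • hhat k := by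
      rw [hHhat, hw, ← sum_smul_vecMulVec_mulVec hhat (fun n => (p n : ℂ)), ← Matrix.add_mulVec,
        ← Finset.sum_erase_add _ _ (Finset.mem_univ k), ← add_assoc, ← hAdef, Matrix.add_mulVec,
        hAv, Matrix.smul_mulVec, Matrix.vecMulVec_mulVec, ← hs, hc, add_smul, one_smul, mul_smul,
        op_smul_eq_smul]
    have h2 : Hhat *ᵥ Pi.single k 1 = hhat k := by
      rw [Matrix.mulVec_single_one, hHhat]
      rfl
    rw [Matrix.mulVec_sub, Matrix.mulVec_smul, h2, ← h1, add_sub_cancel_right]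
  have hDw : D *ᵥ w = Γ *ᵥ (c • Pi.single k 1 - w) := by
    rw [hΓ, Matrix.smul_mulVec, ← Matrix.mulVec_mulVec, ← hZv, Matrix.mulVec_mulVec,
      Matrix.mul_assoc, Matrix.nonsing_inv_mul _ hZu, Matrix.mul_one]
    ext n
    have h : (Hhatᴴ *ᵥ v) n = star (hhat n) ⬝ᵥ v := by
      rw [hHhat]
      rfl
    rw [hDdef, Matrix.mulVec_diagonal, Pi.smul_apply, h, hw, smul_eq_mul]
    field_simp [hpC n]
  have hQw : (D + Γ) *ᵥ (c • Pi.single k 1 - w) = (c * (M * p k : ℂ)⁻¹) • Pi.single k 1 := by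
    rw [Matrix.add_mulVec, ← hDw, ← Matrix.mulVec_add, sub_add_cancel, Matrix.mulVec_smul, hDdef,
      Matrix.diagonal_mulVec_single, mul_smul, ← Pi.single_smul, ← Pi.single_smul,
      ← Pi.single_smul]
    simp only [smul_eq_mul, mul_one]
  have hcq : 1 = c * (M * p k : ℂ)⁻¹ * q := by
    have h := congrFun (congrArg ((D + Γ)⁻¹ *ᵥ ·) hQw) k
    simp only [Matrix.mulVec_mulVec, Matrix.nonsing_inv_mul _ hQu, Matrix.one_mulVec,
      Matrix.mulVec_smul, Matrix.mulVec_single_one, Pi.sub_apply, Pi.smul_apply, Pi.single_eq_same,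
      smul_eq_mul, Matrix.col_apply] at h
    rw [← hqdef] at h
    rw [← h, hw, hc]
    simp only [← hs]
    ring
  have hq_im : q.im = 0 := (Complex.pos_iff.mp hq).2.symm
  have hs_im : s.im = 0 := (Complex.nonneg_iff.mp hs_nonneg).2.symm
  refine ⟨hA.isUnit, ?_, hq_im, (Complex.pos_iff.mp hq).1, ?_, ?_⟩
  · have h : ((M : ℂ) * p k)⁻¹ = (((M * p k)⁻¹ : ℝ) : ℂ) := by push_cast; rfl
    rw [hnum, h, Complex.sub_im, Complex.im_ofReal_mul, hq_im, Complex.one_im, mul_zero, sub_zero]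
  · rw [Complex.im_ofReal_mul, hs_im, mul_zero]
  · have hpk := hpC k
    have hq0 := hq.ne'
    rw [hnum, eq_div_iff hq0]
    rw [hc] at hcq
    field_simp at hcq ⊢
    linear_combination -hcq
end
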